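/- (FASD upper bound) Suppose the space decomposition V = V₁ + ⋯ + V_N by closed subspaces satisfies (SS1) with constant C_A and (SS2) with constant C_S, E satisfies (E1)–(E2), each local energy E_i : V_i → ℝ satisfies (E3) with constant μ_i and (E4) with Lipschitz constant L_i on B_i := Q_i B⁺, and Q_i : V → V_i are linear projections (Q_i w = w for w ∈ V_i). Let u^k = v₀ ∈ B and, for i = 1, …, N: ξ_i := Q_i v_{i−1}; η_i ∈ V_i solves ⟨E_i'(η_i), w⟩ = ⟨E_i'(ξ_i) − E'(v_{i−1}), w⟩ for all w ∈ V_i; s_i := η_i − ξ_i; α_i* is the global minimizer of α ↦ E(v_{i−1} + α s_i); ε_i := α_i* s_i; v_i := v_{i−1} + ε_i; u^{k+1} := v_N. Then E(u^{k+1}) − E(u) ≤ C_U Σ_{i=1}^N ‖ε_i‖² with C_U := C_A² [C_S + L(1 + max_i {L_i/μ_i})]² / (2μ), where u is the global minimizer of E. -/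

import Mathlib

theorem aux_strong {V : Type*} [NormedAddCommGroup V] [InnerProductSpace ℝ V]
    (E : V → ℝ) (E' : V → V →L[ℝ] ℝ)
    (hdiff : ∀ v : V, HasFDerivAt E (E' v) v) (μ : ℝ)
    (hE1 : ∀ v w : V, μ * ‖w - v‖ ^ 2 ≤ E' w (w - v) - E' v (w - v)) (v h : V) :
    E v + E' v h + μ / 2 * ‖h‖ ^ 2 ≤ E (v + h) := by
  have hd : ∀ t : ℝ, HasDerivAt (fun t : ℝ => E (v + t • h) - μ / 2 * ‖h‖ ^ 2 * t ^ 2 - E' v h * t)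
      (E' (v + t • h) h - μ / 2 * ‖h‖ ^ 2 * (2 * t) - E' v h) t := by
    intro t
    have h1 : HasDerivAt (fun t : ℝ => v + t • h) h t := by
      simpa using ((hasDerivAt_id t).smul_const h).const_add v
    have h2 := (hdiff (v + t • h)).comp_hasDerivAt t h1
    have h3 : HasDerivAt (fun t : ℝ => μ / 2 * ‖h‖ ^ 2 * t ^ 2) (μ / 2 * ‖h‖ ^ 2 * (2 * t)) t := by
      simpa using (hasDerivAt_pow 2 t).const_mul (μ / 2 * ‖h‖ ^ 2)
    have h4 : HasDerivAt (fun t : ℝ => E' v h * t) (E' v h) t := by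
      simpa using (hasDerivAt_id t).const_mul (E' v h)
    exact (h2.sub h3).sub h4
  have hm : MonotoneOn (fun t : ℝ => E (v + t • h) - μ / 2 * ‖h‖ ^ 2 * t ^ 2 - E' v h * t)
      (Set.Icc 0 1) := by
    apply monotoneOn_of_deriv_nonneg (convex_Icc 0 1)
    · exact fun t _ => (hd t).continuousAt.continuousWithinAt
    · exact fun t _ => (hd t).differentiableAt.differentiableWithinAt
    · intro t ht
      rw [interior_Icc] at ht
      rw [(hd t).deriv]
      have := hE1 v (v + t • h)
      simp only [add_sub_cancel_left, map_smul, smul_eq_mul, norm_smul, Real.norm_eq_abs] at this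
      rw [abs_of_pos ht.1] at this
      have h5 : t * (μ * ‖h‖ ^ 2 * t) ≤ t * (E' (v + t • h) h - E' v h) := by nlinarith
      have := le_of_mul_le_mul_left h5 ht.1
      linarith
  have := hm (by simp : (0 : ℝ) ∈ Set.Icc 0 1) (by simp : (1 : ℝ) ∈ Set.Icc 0 1) zero_le_one
  simp at this
  linarith

theorem aux_conv {V : Type*} [NormedAddCommGroup V] [InnerProductSpace ℝ V]
    (E : V → ℝ) (E' : V → V →L[ℝ] ℝ)
    (hdiff : ∀ v : V, HasFDerivAt E (E' v) v) (μ : ℝ) (hμ : 0 < μ)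
    (hE1 : ∀ v w : V, μ * ‖w - v‖ ^ 2 ≤ E' w (w - v) - E' v (w - v)) (x h : V)
    (t : ℝ) (h0 : 0 ≤ t) (h1 : t ≤ 1) :
    E (x + t • h) ≤ (1 - t) * E x + t * E (x + h) := by
  have a := aux_strong E E' hdiff μ hE1 (x + t • h) (-(t • h))
  have b := aux_strong E E' hdiff μ hE1 (x + t • h) ((1 - t) • h)
  have e1 : x + t • h + -(t • h) = x := by abel
  have e2 : x + t • h + (1 - t) • h = x + h := by module
  rw [e1] at a
  rw [e2] at b
  simp only [map_neg, map_smul, smul_eq_mul] at a b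
  have p1 : 0 ≤ μ / 2 * ‖-(t • h)‖ ^ 2 := by positivity
  have p2 : 0 ≤ μ / 2 * ‖(1 - t) • h‖ ^ 2 := by positivity
  have a' : E (x + t • h) - t * E' (x + t • h) h ≤ E x := by linarith
  have b' : E (x + t • h) + (1 - t) * E' (x + t • h) h ≤ E (x + h) := by linarith
  have := mul_le_mul_of_nonneg_left a' (sub_nonneg.2 h1)
  have := mul_le_mul_of_nonneg_left b' h0
  linarith

theorem aux_tele {G : Type*} [AddCommGroup G] (N : ℕ) (f : Fin (N + 1) → G) (i : Fin N) :
    ∑ j : Fin N, (if i < j then f j.succ - f j.castSucc else 0) = f (Fin.last N) - f i.succ := by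
  induction N with
  | zero => exact i.elim0
  | succ n ih =>
    rw [Fin.sum_univ_castSucc]
    induction i using Fin.lastCases with
    | last =>
      have : ∀ j : Fin n, ¬ (Fin.last n < j.castSucc) := fun j => not_lt.2 (Fin.le_last _)
      simp [this]
    | cast i =>
      have := ih (fun k => f k.castSucc) i
      simp only [Fin.castSucc_lt_castSucc_iff, Fin.castSucc_lt_last, if_true, Fin.succ_last,
        Fin.succ_castSucc] at this ⊢
      rw [this]
      abel


/-- FASD upper bound: under (SS1), (SS2), (E1)–(E2) and the local assumptions
(E3)–(E4) (the latter on B_i = Q_i B⁺, where B⁺ is the √χ-enlargement of the sublevel set B),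
one FASD iteration with exact line searches satisfies
E(u^{k+1}) − E(u) ≤ C_A² [C_S + L(1 + max_i L_i/μ_i)]² / (2μ) · Σ ‖ε_i‖². -/
theorem stmt_15
    {V : Type*} [NormedAddCommGroup V] [InnerProductSpace ℝ V] [CompleteSpace V]
    (E : V → ℝ) (E' : V → V →L[ℝ] ℝ)
    (hdiff : ∀ v : V, HasFDerivAt E (E' v) v)
    (μ L : ℝ) (hμ : 0 < μ) (hL : 0 < L) (u₀ : V)
    (hE1 : ∀ v w : V, μ * ‖w - v‖ ^ 2 ≤ E' w (w - v) - E' v (w - v))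
    (hE2 : ∀ v ∈ {x : V | E x ≤ E u₀}, ∀ w ∈ {x : V | E x ≤ E u₀},
      ‖E' w - E' v‖ ≤ L * ‖w - v‖)
    (u : V) (hu : ∀ x : V, E u ≤ E x)
    (N : ℕ) (hN : (Finset.univ : Finset (Fin N)).Nonempty)
    (Vsub : Fin N → Submodule ℝ V)
    (hclosed : ∀ i, IsClosed ((Vsub i : Set V)))
    (CA CS : ℝ) (hCA : 0 < CA) (hCS : 0 < CS)
    (hSS1 : ∀ x : V, ∃ c : Fin N → V, (∀ i, c i ∈ Vsub i) ∧ x = ∑ i, c i ∧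
      ∑ i, ‖c i‖ ^ 2 ≤ CA ^ 2 * ‖x‖ ^ 2)
    (hSS2 : ∀ (w : Fin N → Fin N → V) (uu vv : Fin N → V),
      (∀ i j, E (w i j) ≤ E u₀) → (∀ i, uu i ∈ Vsub i) → (∀ i, vv i ∈ Vsub i) →
      (∀ i j, E (w i j + uu i) ≤ E u₀) →
      ∑ i, ∑ j ∈ Finset.univ.filter (fun j => i < j),
          (E' (w i j + uu j) (vv i) - E' (w i j) (vv i)) ≤
        CS * Real.sqrt (∑ i, ‖uu i‖ ^ 2) * Real.sqrt (∑ i, ‖vv i‖ ^ 2))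
    (Q : Fin N → V →ₗ[ℝ] V)
    (hQmem : ∀ i x, Q i x ∈ Vsub i)
    (hQproj : ∀ i, ∀ x ∈ Vsub i, Q i x = x)
    (Ei : Fin N → V → ℝ) (Ei' : Fin N → V → V →L[ℝ] ℝ)
    (hEidiff : ∀ i, ∀ x ∈ (Vsub i : Set V),
      HasFDerivWithinAt (Ei i) (Ei' i x) (Vsub i : Set V) x)
    (μi Li : Fin N → ℝ) (hμi : ∀ i, 0 < μi i) (hLi : ∀ i, 0 < Li i)
    (hE3 : ∀ i, ∀ v ∈ Vsub i, ∀ w ∈ Vsub i,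
      μi i * ‖w - v‖ ^ 2 ≤ Ei' i w (w - v) - Ei' i v (w - v))
    (hE4 : ∀ i,
      ∀ v ∈ (fun x => Q i x) '' {x : V |
        Metric.infDist x {y : V | E y ≤ E u₀} ≤
          Real.sqrt (2 * L ^ 2 / (μ * (Finset.univ.inf' hN μi) ^ 2) * (E u₀ - E u))},
      ∀ w ∈ (fun x => Q i x) '' {x : V |
        Metric.infDist x {y : V | E y ≤ E u₀} ≤
          Real.sqrt (2 * L ^ 2 / (μ * (Finset.univ.inf' hN μi) ^ 2) * (E u₀ - E u))},
      ‖Ei' i w - Ei' i v‖ ≤ Li i * ‖w - v‖)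
    (v : Fin (N + 1) → V) (hv0 : E (v 0) ≤ E u₀)
    (ξ η s ε : Fin N → V) (αstar : Fin N → ℝ)
    (hξ : ∀ i, ξ i = Q i (v i.castSucc))
    (hηmem : ∀ i, η i ∈ Vsub i)
    (hres : ∀ i, ∀ w ∈ Vsub i,
      Ei' i (η i) w = Ei' i (ξ i) w - E' (v i.castSucc) w)
    (hs : ∀ i, s i = η i - ξ i)
    (hα : ∀ i, ∀ α : ℝ,
      E (v i.castSucc + αstar i • s i) ≤ E (v i.castSucc + α • s i))
    (hε : ∀ i, ε i = αstar i • s i)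
    (hstep : ∀ i, v i.succ = v i.castSucc + ε i) :
    E (v (Fin.last N)) - E u ≤
      CA ^ 2 * (CS + L * (1 + Finset.univ.sup' hN (fun i => Li i / μi i))) ^ 2 / (2 * μ) *
        ∑ i, ‖ε i‖ ^ 2 := by
  have hsc := aux_strong E E' hdiff μ hE1
  have hcv := aux_conv E E' hdiff μ hμ hE1
  have hξm : ∀ i, ξ i ∈ Vsub i := fun i => by rw [hξ]; exact hQmem i _
  have hsm : ∀ i, s i ∈ Vsub i := fun i => by
    rw [hs]; exact (Vsub i).sub_mem (hηmem i) (hξm i)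
  have hεm : ∀ i, ε i ∈ Vsub i := fun i => by
    rw [hε]; exact (Vsub i).smul_mem _ (hsm i)
  -- line search optimality
  have hopt : ∀ i, E' (v i.succ) (s i) = 0 := by
    intro i
    have h1 : HasDerivAt (fun t : ℝ => v i.castSucc + t • s i) (s i) (αstar i) := by
      simpa using ((hasDerivAt_id (αstar i)).smul_const (s i)).const_add (v i.castSucc)
    have h2 := (hdiff (v i.castSucc + αstar i • s i)).comp_hasDerivAt _ h1
    have h3 : IsLocalMin (E ∘ fun t : ℝ => v i.castSucc + t • s i) (αstar i) :=
      Filter.Eventually.of_forall (fun α => hα i α)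
    have := h3.hasDerivAt_eq_zero h2
    rw [hstep, hε]; exact this
  have hdec : ∀ i, E (v i.succ) + μ / 2 * ‖ε i‖ ^ 2 ≤ E (v i.castSucc) := by
    intro i
    have := hsc (v i.succ) (-(ε i))
    have e : v i.succ + -ε i = v i.castSucc := by rw [hstep]; abel
    have e2 : E' (v i.succ) (ε i) = 0 := by rw [hε, map_smul, hopt, smul_zero]
    rw [e, map_neg, e2, norm_neg] at this
    linarith
  have hanti : Antitone (fun k => E (v k)) := by
    rw [Fin.antitone_iff_succ_le]
    intro i
    have := hdec i
    have : 0 ≤ μ / 2 * ‖ε i‖ ^ 2 := by positivity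
    linarith
  have hB : ∀ k, E (v k) ≤ E u₀ := fun k => (hanti (Fin.zero_le k)).trans hv0
  have hLip : ∀ i, ‖E' (v i.succ) - E' (v i.castSucc)‖ ≤ L * ‖ε i‖ := by
    intro i
    have := hE2 (v i.castSucc) (hB _) (v i.succ) (hB _)
    have e : v i.succ - v i.castSucc = ε i := by rw [hstep]; abel
    rwa [e] at this
  have hsb : ∀ i, μi i * ‖s i‖ ≤ L * ‖ε i‖ := by
    intro i
    have h1 := hE3 i (ξ i) (hξm i) (η i) (hηmem i)
    rw [← hs, hres i _ (hsm i)] at h1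
    have h2 : (E' (v i.succ) - E' (v i.castSucc)) (s i) ≤ L * ‖ε i‖ * ‖s i‖ :=
      (le_abs_self _).trans (((E' (v i.succ) - E' (v i.castSucc)).le_opNorm (s i)).trans
        (mul_le_mul_of_nonneg_right (hLip i) (norm_nonneg _)))
    simp only [ContinuousLinearMap.sub_apply, hopt] at h2
    rcases (norm_nonneg (s i)).eq_or_lt with h | h
    · rw [← h, mul_zero]; positivity
    · exact le_of_mul_le_mul_right (by nlinarith) h
  -- local Lipschitz
  have hloc : ∀ i, ‖Ei' i (η i) - Ei' i (ξ i)‖ ≤ Li i * ‖s i‖ := by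
    intro i
    have hm0 : 0 < Finset.univ.inf' hN μi := by
      rw [Finset.lt_inf'_iff]; exact fun i _ => hμi i
    have hmi : Finset.univ.inf' hN μi ≤ μi i := Finset.inf'_le _ (Finset.mem_univ i)
    rw [hs i]
    apply hE4 i
    · refine ⟨v i.castSucc, ?_, (hξ i).symm⟩
      simp only [Set.mem_setOf_eq]
      rw [Metric.infDist_zero_of_mem (show v i.castSucc ∈ {y : V | E y ≤ E u₀} from hB _)]
      exact Real.sqrt_nonneg _
    · refine ⟨v i.castSucc + s i, ?_, ?_⟩
      · simp only [Set.mem_setOf_eq]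
        refine (Metric.infDist_le_dist_of_mem
          (show v i.castSucc ∈ {y : V | E y ≤ E u₀} from hB _)).trans ?_
        rw [dist_eq_norm, add_sub_cancel_left]
        apply Real.le_sqrt_of_sq_le
        set m := Finset.univ.inf' hN μi
        have h1 : m * ‖s i‖ ≤ L * ‖ε i‖ :=
          (mul_le_mul_of_nonneg_right hmi (norm_nonneg _)).trans (hsb i)
        have h2 : (m * ‖s i‖) ^ 2 ≤ (L * ‖ε i‖) ^ 2 := by gcongr
        have h3 : μ / 2 * ‖ε i‖ ^ 2 ≤ E u₀ - E u := by
          have := hdec i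
          have := hB i.castSucc
          have := hu (v i.succ)
          linarith
        rw [div_mul_eq_mul_div, le_div_iff₀ (by positivity)]
        have h4 := mul_le_mul_of_nonneg_left h3 (show 0 ≤ 2 * L ^ 2 by positivity)
        have h5 := mul_le_mul_of_nonneg_left h2 hμ.le
        linarith
      · simp only [map_add]
        rw [← hξ, hQproj i _ (hsm i), hs]; abel
  -- segment bounds
  have hseg : ∀ j, ∀ t : ℝ, 0 ≤ t → t ≤ 1 → E (v j.castSucc + t • ε j) ≤ E (v j.castSucc) := by
    intro j t h0 h1
    have h := hcv (v j.castSucc) (ε j) t h0 h1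
    rw [← hstep] at h
    have h2 : E (v j.succ) ≤ E (v j.castSucc) := hanti (Fin.castSucc_lt_succ).le
    have := mul_le_mul_of_nonneg_left h2 h0
    linarith
  -- derived SS2
  have key : ∀ c : Fin N → V, (∀ i, c i ∈ Vsub i) →
      ∑ i, (E' (v (Fin.last N)) (c i) - E' (v i.succ) (c i)) ≤
        CS * Real.sqrt (∑ i, ‖ε i‖ ^ 2) * Real.sqrt (∑ i, ‖c i‖ ^ 2) := by
    intro c hc
    have hev : ∀ i j : Fin N, ∀ᶠ n : ℕ in Filter.atTop, i < j → ∀ t : ℝ, 0 ≤ t → t ≤ 1 →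
        E (v j.castSucc + t • ε j + (1 / ((n : ℝ) + 1)) • ε i) ≤ E u₀ := by
      intro i j
      by_cases hij : i < j
      swap
      · exact Filter.Eventually.of_forall (fun n h => absurd h hij)
      by_cases he : ε i = 0
      · refine Filter.Eventually.of_forall (fun n _ t h0 h1 => ?_)
        rw [he, smul_zero, add_zero]
        exact (hseg j t h0 h1).trans (hB _)
      have hlt : E (v j.castSucc) < E u₀ := by
        have h1 : E (v j.castSucc) ≤ E (v i.succ) := hanti (by
          rw [Fin.le_def]; simp; exact hij)
        have h2 := hdec i
        have h3 : 0 < μ / 2 * ‖ε i‖ ^ 2 := by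
          have := norm_pos_iff.2 he
          positivity
        have := hB i.castSucc
        linarith
      set M := max (E (v j.castSucc + ε i)) (E (v j.castSucc + ε i + ε j))
      have hlim : Filter.Tendsto (fun n : ℕ => (1 - 1 / ((n : ℝ) + 1)) * E (v j.castSucc)
          + 1 / ((n : ℝ) + 1) * M) Filter.atTop (nhds ((1 - 0) * E (v j.castSucc) + 0 * M)) := by
        have := tendsto_one_div_add_atTop_nhds_zero_nat (𝕜 := ℝ)
        exact ((tendsto_const_nhds.sub this).mul_const _).add (this.mul_const _)
      have := hlim.eventually (gt_mem_nhds (show (1 - 0) * E (v j.castSucc) + 0 * M < E u₀ by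
        linarith))
      filter_upwards [this] with n hn _ t h0 h1
      have hp : (0 : ℝ) < (n : ℝ) + 1 := by positivity
      have q0 : 0 ≤ 1 / ((n : ℝ) + 1) := by positivity
      have q1 : 1 / ((n : ℝ) + 1) ≤ 1 := by
        rw [div_le_one hp]; have : (0 : ℝ) ≤ n := Nat.cast_nonneg n
        linarith
      have a := hcv (v j.castSucc + t • ε j) (ε i) _ q0 q1
      have b := hcv (v j.castSucc + ε i) (ε j) t h0 h1
      have e : v j.castSucc + t • ε j + ε i = v j.castSucc + ε i + t • ε j := by abel
      rw [e] at a
      have b' : E (v j.castSucc + ε i + t • ε j) ≤ M := by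
        have := mul_le_mul_of_nonneg_left
          (le_max_left (E (v j.castSucc + ε i)) (E (v j.castSucc + ε i + ε j))) (sub_nonneg.2 h1)
        have := mul_le_mul_of_nonneg_left
          (le_max_right (E (v j.castSucc + ε i)) (E (v j.castSucc + ε i + ε j))) h0
        simp only [M]
        linarith
      have := mul_le_mul_of_nonneg_left b' q0
      have := mul_le_mul_of_nonneg_left (hseg j t h0 h1) (sub_nonneg.2 q1)
      linarith
    obtain ⟨n, hn⟩ := (Filter.eventually_all.2 (fun i => Filter.eventually_all.2 (hev i))).exists
    have hp : (0 : ℝ) < (n : ℝ) + 1 := by positivity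
    set q : ℝ := 1 / ((n : ℝ) + 1) with hq
    have hq0 : 0 ≤ q := by positivity
    have hnq : ((n : ℝ) + 1) * q = 1 := by rw [hq]; field_simp
    have hq1 : q ≤ 1 := by nlinarith [(Nat.cast_nonneg n : (0 : ℝ) ≤ n)]
    have hstepm : ∀ m ∈ Finset.range (n + 1),
        ∑ i, ∑ j ∈ Finset.univ.filter (fun j => i < j),
          (E' (v j.castSucc + (((m + 1 : ℕ) : ℝ) * q) • ε j) (c i)
            - E' (v j.castSucc + ((m : ℝ) * q) • ε j) (c i)) ≤
        q * (CS * Real.sqrt (∑ i, ‖ε i‖ ^ 2) * Real.sqrt (∑ i, ‖c i‖ ^ 2)) := by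
      intro m hm
      have hm1 : (m : ℝ) + 1 ≤ (n : ℝ) + 1 := by
        exact_mod_cast Finset.mem_range.1 hm
      have hm0 : (0 : ℝ) ≤ m := Nat.cast_nonneg m
      have t0 : 0 ≤ (m : ℝ) * q := by positivity
      have t1 : (m : ℝ) * q ≤ 1 := by nlinarith
      have h := hSS2 (fun i j => if i < j then v j.castSucc + ((m : ℝ) * q) • ε j
          else v i.castSucc) (fun i => q • ε i) c ?_ ?_ hc ?_
      · have e1 : Real.sqrt (∑ i, ‖q • ε i‖ ^ 2) = q * Real.sqrt (∑ i, ‖ε i‖ ^ 2) := by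
          simp only [norm_smul, mul_pow, Real.norm_eq_abs, sq_abs]
          rw [← Finset.mul_sum, Real.sqrt_mul (sq_nonneg q), Real.sqrt_sq hq0]
        rw [e1] at h
        refine le_trans (le_of_eq ?_) (h.trans (le_of_eq (by ring)))
        refine Finset.sum_congr rfl fun i _ => Finset.sum_congr rfl fun j hj => ?_
        have hij : i < j := (Finset.mem_filter.1 hj).2
        simp only [hij, if_true]
        have e2 : v j.castSucc + ((m : ℝ) * q) • ε j + q • ε j =
            v j.castSucc + (((m + 1 : ℕ) : ℝ) * q) • ε j := by
          push_cast; module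
        rw [e2]
      · intro i j
        split_ifs
        · exact (hseg j _ t0 t1).trans (hB _)
        · exact hB _
      · exact fun i => (Vsub i).smul_mem _ (hεm i)
      · intro i j
        split_ifs with hij
        · exact hn i j hij _ t0 t1
        · exact (hseg i _ hq0 hq1).trans (hB _)
    have hsum := Finset.sum_le_sum hstepm
    rw [Finset.sum_const, Finset.card_range, nsmul_eq_mul, ← mul_assoc] at hsum
    push_cast at hsum
    rw [hnq, one_mul] at hsum
    refine le_trans (le_of_eq ?_) hsum
    rw [Finset.sum_comm]
    refine Finset.sum_congr rfl fun i _ => ?_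
    rw [Finset.sum_comm, Finset.sum_filter]
    have ht := aux_tele N (fun k => E' (v k) (c i)) i
    rw [← ht]
    refine Finset.sum_congr rfl fun j _ => ?_
    congr 1
    have hr := Finset.sum_range_sub
      (fun m : ℕ => E' (v j.castSucc + ((m : ℝ) * q) • ε j) (c i)) (n + 1)
    push_cast at hr
    rw [hr, hnq, one_smul, zero_mul, zero_smul, add_zero, ← hstep]
  -- conclusion
  obtain ⟨c, hc, hcs, hcb⟩ := hSS1 (v (Fin.last N) - u)
  set R := Finset.univ.sup' hN (fun i => Li i / μi i)
  have hRi : ∀ i, Li i / μi i ≤ R := fun i =>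
    Finset.le_sup' (fun i => Li i / μi i) (Finset.mem_univ i)
  have hR0 : 0 ≤ R := by
    obtain ⟨i, _⟩ := hN
    exact (div_pos (hLi i) (hμi i)).le.trans (hRi i)
  have hterm : ∀ i, E' (v i.succ) (c i) ≤ L * (1 + R) * (‖ε i‖ * ‖c i‖) := by
    intro i
    have h1 : (E' (v i.succ) - E' (v i.castSucc)) (c i) ≤ L * ‖ε i‖ * ‖c i‖ :=
      (le_abs_self _).trans (((E' (v i.succ) - E' (v i.castSucc)).le_opNorm (c i)).trans
        (mul_le_mul_of_nonneg_right (hLip i) (norm_nonneg _)))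
    have h2 : -((Ei' i (η i) - Ei' i (ξ i)) (c i)) ≤ Li i * ‖s i‖ * ‖c i‖ :=
      (neg_le_abs _).trans (((Ei' i (η i) - Ei' i (ξ i)).le_opNorm (c i)).trans
        (mul_le_mul_of_nonneg_right (hloc i) (norm_nonneg _)))
    have h3 := hres i (c i) (hc i)
    have h4 : Li i * ‖s i‖ ≤ R * (L * ‖ε i‖) := by
      have : Li i * ‖s i‖ = Li i / μi i * (μi i * ‖s i‖) := by
        have := (hμi i).ne'
        field_simp
      rw [this]
      exact mul_le_mul (hRi i) (hsb i) (mul_nonneg (hμi i).le (norm_nonneg _)) hR0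
    have h5 := mul_le_mul_of_nonneg_right h4 (norm_nonneg (c i))
    simp only [ContinuousLinearMap.sub_apply] at h1 h2
    nlinarith
  set X := Real.sqrt (∑ i, ‖ε i‖ ^ 2) with hX
  set Y := Real.sqrt (∑ i, ‖c i‖ ^ 2) with hY
  have hX2 : X ^ 2 = ∑ i, ‖ε i‖ ^ 2 := Real.sq_sqrt (by positivity)
  have hX0 : 0 ≤ X := Real.sqrt_nonneg _
  have hcs2 : ∑ i, ‖ε i‖ * ‖c i‖ ≤ X * Y := Real.sum_mul_le_sqrt_mul_sqrt _ _ _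
  set d := v (Fin.last N) - u with hd
  have hYd : Y ≤ CA * ‖d‖ := by
    apply Real.sqrt_le_iff.2
    exact ⟨by positivity, by rw [mul_pow]; exact hcb⟩
  have hmain : E' (v (Fin.last N)) d ≤ (CS + L * (1 + R)) * X * Y := by
    have h1 := key c hc
    have h2 : ∑ i, E' (v i.succ) (c i) ≤ L * (1 + R) * (X * Y) := by
      refine (Finset.sum_le_sum fun i _ => hterm i).trans ?_
      rw [← Finset.mul_sum]
      exact mul_le_mul_of_nonneg_left hcs2 (by positivity)
    rw [Finset.sum_sub_distrib] at h1
    rw [hcs, map_sum]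
    linarith
  have hfin := hsc (v (Fin.last N)) (-d)
  have e : v (Fin.last N) + -d = u := by rw [hd]; abel
  rw [e, map_neg, norm_neg] at hfin
  have hK0 : 0 ≤ CS + L * (1 + R) := by positivity
  set K := CS + L * (1 + R)
  have h6 : K * X * Y ≤ K * X * (CA * ‖d‖) :=
    mul_le_mul_of_nonneg_left hYd (by positivity)
  rw [← hX2, div_mul_eq_mul_div, le_div_iff₀ (by positivity)]
  have h7 : E (v (Fin.last N)) - E u ≤ K * X * (CA * ‖d‖) - μ / 2 * ‖d‖ ^ 2 := by linarith
  have h8 := mul_le_mul_of_nonneg_right h7 (show 0 ≤ 2 * μ by positivity)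
  nlinarith [sq_nonneg (K * X * CA - μ * ‖d‖)]
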